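/- Consider the first-order system (AA) in the variables (θ₁,θ₂,r₁,r₂): for i = 1,2 (indices cyclic), dθ_i/dt = n − (γ_i/(2r_i))·C_i(θ_i/n)·[p_i(t) − φ_i(γ_{i+1}·r_{i+1}·C_{i+1}(θ_{i+1}/n))] and dr_i/dt = (γ_i/(2n))·C_i'(θ_i/n)·[p_i(t) − φ_i(γ_{i+1}·r_{i+1}·C_{i+1}(θ_{i+1}/n))]. Then for every δ > 0 there exists R > 0 such that: for every θ₀ ∈ ℝ² and every r₀ ∈ [R,∞)², the solution (θ(t), r(t)) of (AA) with (θ(0), r(0)) = (θ₀, r₀) exists on [0,2π] with r_i(t) > 0 throughout, and satisfies, for i = 1,2, |r_i(2π) − r_{0,i} + ∂L_i/∂θ_i(θ₀)| ≤ δ and |r_{0,i}·(θ_i(2π) − θ_{0,i} − 2πn) − L_i(θ₀)| ≤ δ. -/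

import Mathlib

open Real MeasureTheory Filter

noncomputable section

/-- `C` is the asymmetric cosine of the pair `(a, b)` for the resonance integer `n`:
the even, `2π/n`-periodic function equal to `cos(√a t)` on `[0, π/(2√a)]` and to
`−√(a/b)·sin(√b(t − π/(2√a)))` on `[π/(2√a), π/n]`. -/
def IsAsymCos (n : ℕ) (a b : ℝ) (C : ℝ → ℝ) : Prop :=
  (∀ t, C (-t) = C t) ∧ (∀ t, C (t + 2 * π / n) = C t) ∧
  (∀ t ∈ Set.Icc (0 : ℝ) (π / (2 * Real.sqrt a)), C t = Real.cos (Real.sqrt a * t)) ∧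
  (∀ t ∈ Set.Icc (π / (2 * Real.sqrt a)) (π / n),
      C t = - Real.sqrt (a / b) * Real.sin (Real.sqrt b * (t - π / (2 * Real.sqrt a))))

lemma aux_glue {f g f' g' : ℝ → ℝ} {h : ℝ} (hf : ∀ t, HasDerivAt f (f' t) t)
    (hg : ∀ t, HasDerivAt g (g' t) t) (h0 : f h = g h) (h1 : f' h = g' h) (t : ℝ) :
    HasDerivAt (fun s => if s ≤ h then f s else g s) (if t ≤ h then f' t else g' t) t := by
  rcases lt_trichotomy t h with ht | ht | ht
  · rw [if_pos ht.le]
    refine (hf t).congr_of_eventuallyEq ?_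
    filter_upwards [Iio_mem_nhds ht] with s hs
    rw [if_pos (le_of_lt hs)]
  · subst ht
    rw [if_pos le_rfl]
    have hL : HasDerivWithinAt (fun s => if s ≤ t then f s else g s) (f' t) (Set.Iic t) t := by
      refine (hf t).hasDerivWithinAt.congr ?_ ?_
      · intro s hs; exact if_pos hs
      · exact if_pos le_rfl
    have hR : HasDerivWithinAt (fun s => if s ≤ t then f s else g s) (f' t) (Set.Ici t) t := by
      rw [h1]
      refine (hg t).hasDerivWithinAt.congr ?_ ?_
      · intro s hs
        rcases eq_or_lt_of_le (Set.mem_Ici.1 hs) with e | e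
        · subst e; simp [h0]
        · exact if_neg (not_le.2 e)
      · simp [h0]
    have := hL.union hR
    rw [Set.Iic_union_Ici] at this
    exact hasDerivWithinAt_univ.1 this
  · rw [if_neg (not_le.2 ht)]
    refine (hg t).congr_of_eventuallyEq ?_
    filter_upwards [Ioi_mem_nhds ht] with s hs
    rw [if_neg (not_le.2 hs)]

/-- the shape of an asymmetric cosine on a full period -/
structure AsymShape (A B h T : ℝ) (C : ℝ → ℝ) : Prop where
  hA : 0 < A
  hB : 0 < B
  hh : A * h = π / 2
  hT : B * (T - 2 * h) = π
  even : ∀ t, C (-t) = C t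
  per : ∀ t, C (t + T) = C t
  pos : ∀ t ∈ Set.Icc (-h) h, C t = cos (A * t)
  neg : ∀ t ∈ Set.Icc h (T - h), C t = - (A / B) * sin (B * (t - h))

lemma asymShape_of (n : ℕ) (hn : 1 ≤ n) (a b : ℝ) (ha : (n : ℝ) ^ 2 / 4 < a) (hb : 0 < b)
    (hres : 1 / Real.sqrt a + 1 / Real.sqrt b = 2 / (n : ℝ)) (C : ℝ → ℝ) (hC : IsAsymCos n a b C) :
    AsymShape (√a) (√b) (π / (2 * √a)) (2 * π / n) C := by
  have hn0 : (0 : ℝ) < n := by exact_mod_cast hn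
  have ha0 : 0 < a := lt_of_le_of_lt (by positivity) ha
  have hA : 0 < √a := Real.sqrt_pos.2 ha0
  have hB : 0 < √b := Real.sqrt_pos.2 hb
  obtain ⟨h1, h2, h3, h4⟩ := hC
  rw [Real.sqrt_div' _ hb.le] at h4
  have hh : √a * (π / (2 * √a)) = π / 2 := by field_simp
  have e : 2 * π / n = π * (1 / √a + 1 / √b) := by rw [hres]; ring
  have hT : √b * (2 * π / n - 2 * (π / (2 * √a))) = π := by
    rw [e]; field_simp; ring
  have hmid : 2 * (π / n) = 2 * π / n := by ring
  refine ⟨hA, hB, hh, hT, h1, h2, ?_, ?_⟩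
  · intro t ht
    rcases le_total 0 t with h | h
    · exact h3 t ⟨h, ht.2⟩
    · rw [← h1 t, h3 (-t) ⟨by linarith, by linarith [ht.1]⟩, mul_neg, cos_neg]
  · intro t ht
    rcases le_total t (π / n) with h | h
    · exact h4 t ⟨ht.1, h⟩
    · have e1 : C t = C (2 * π / n - t) := by
        rw [← h1 t, ← h2 (-t)]; congr 1; ring
      rw [e1, h4 _ ⟨by linarith [ht.2], by linarith⟩]
      congr 1
      rw [← Real.sin_pi_sub]
      congr 1
      linear_combination -hT

namespace AsymShape

variable {A B h T : ℝ} {C : ℝ → ℝ}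

lemma h_pos (S : AsymShape A B h T C) : 0 < h := by
  have := S.hh; have := S.hA; have := pi_pos
  by_contra hc
  nlinarith

lemma hT_pos (S : AsymShape A B h T C) : h < T - h := by
  have := S.hT; have := S.hB; have := pi_pos
  by_contra hc
  nlinarith

lemma T_pos (S : AsymShape A B h T C) : 0 < T := by
  have := S.h_pos; have := S.hT_pos; linarith

lemma pos' (S : AsymShape A B h T C) : ∀ t ∈ Set.Ioo (-h) h, 0 < C t := by
  intro t ht
  rw [S.pos t ⟨ht.1.le, ht.2.le⟩]
  have := S.hh; have := S.hA
  apply cos_pos_of_mem_Ioo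
  constructor <;> nlinarith [ht.1, ht.2]

lemma neg' (S : AsymShape A B h T C) : ∀ t ∈ Set.Ioo h (T - h), C t < 0 := by
  intro t ht
  rw [S.neg t ⟨ht.1.le, ht.2.le⟩]
  have h1 := S.hT; have h2 := S.hB; have h3 := S.hA
  have : 0 < sin (B * (t - h)) := by
    apply sin_pos_of_pos_of_lt_pi
    · nlinarith [ht.1]
    · nlinarith [ht.2]
  have := div_pos h3 h2
  rw [neg_mul]
  simp only [Left.neg_neg_iff]
  positivity

lemma integral (S : AsymShape A B h T C) (hc : Continuous C) :
    ∫ t in (-h)..(T - h), C t = 2 * (1 / A - A / B ^ 2) := by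
  have h1 := S.h_pos; have h2 := S.hT_pos; have hA := S.hA; have hB := S.hB
  rw [← intervalIntegral.integral_add_adjacent_intervals (b := h) (hc.intervalIntegrable _ _)
    (hc.intervalIntegrable _ _)]
  have e1 : ∫ t in (-h)..h, C t = ∫ t in (-h)..h, cos (A * t) := by
    apply intervalIntegral.integral_congr
    intro t ht
    rw [Set.uIcc_of_le (by linarith)] at ht
    exact S.pos t ht
  have e2 : ∫ t in h..(T - h), C t = ∫ t in h..(T-h), - (A / B) * sin (B * (t - h)) := by
    apply intervalIntegral.integral_congr
    intro t ht
    rw [Set.uIcc_of_le (by linarith)] at ht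
    exact S.neg t ht
  rw [e1, e2, intervalIntegral.integral_const_mul]
  have i1 : ∫ t in (-h)..h, cos (A * t) = 2 / A := by
    rw [intervalIntegral.integral_comp_mul_left (fun x => cos x) hA.ne', integral_cos, mul_neg, S.hh,
      sin_neg, sin_pi_div_two]
    simp only [smul_eq_mul]; field_simp; ring
  have i2 : ∫ t in h..(T-h), sin (B * (t - h)) = 2 / B := by
    rw [intervalIntegral.integral_comp_sub_right (fun x => sin (B * x)) h,
      intervalIntegral.integral_comp_mul_left (fun x => sin x) hB.ne', integral_sin]
    rw [show B * (T - h - h) = π by linear_combination S.hT]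
    simp only [sub_self, mul_zero, cos_zero, cos_pi, smul_eq_mul]; field_simp; ring
  rw [i1, i2]; field_simp; ring

/-- local regularity predicate -/
def Reg (C : ℝ → ℝ) (M t : ℝ) : Prop :=
  |C t| ≤ M ∧ DifferentiableAt ℝ C t ∧ |deriv C t| ≤ M ∧ DifferentiableAt ℝ (deriv C) t ∧
    |deriv (deriv C) t| ≤ M

lemma reg_congr {C E : ℝ → ℝ} {M t : ℝ} (hE : C =ᶠ[nhds t] E) (H : Reg E M t) : Reg C M t := by
  have h1 : deriv C =ᶠ[nhds t] deriv E := hE.deriv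
  obtain ⟨a1, a2, a3, a4, a5⟩ := H
  refine ⟨by rwa [hE.eq_of_nhds], a2.congr_of_eventuallyEq hE, by rwa [h1.eq_of_nhds],
    a4.congr_of_eventuallyEq h1, by rwa [h1.deriv_eq]⟩

lemma reg_neg {C : ℝ → ℝ} {M t : ℝ} (even : ∀ t, C (-t) = C t) (H : Reg C M (-t)) : Reg C M t := by
  obtain ⟨a1, a2, a3, a4, a5⟩ := H
  have e : C = fun t => C (-t) := funext fun t => (even t).symm
  have d1 : deriv C = fun t => - deriv C (-t) := by
    funext s
    conv_lhs => rw [e]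
    rw [deriv_comp_neg]
  have d2 : deriv (deriv C) = fun t => deriv (deriv C) (-t) := by
    funext s
    conv_lhs => rw [d1]
    rw [deriv.fun_neg, deriv_comp_neg, neg_neg]
  refine ⟨by rwa [← even], ?_, ?_, ?_, ?_⟩
  · rw [e]; exact a2.comp t (differentiable_neg t)
  · rw [d1]; simpa using a3
  · rw [d1]; exact (a4.comp t (differentiable_neg t)).neg
  · rw [d2]; exact a5

lemma reg_add {C : ℝ → ℝ} {M t T : ℝ} (per : ∀ t, C (t + T) = C t) (H : Reg C M (t + T)) :
    Reg C M t := by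
  obtain ⟨a1, a2, a3, a4, a5⟩ := H
  have e : C = fun t => C (t + T) := funext fun t => (per t).symm
  have d1 : deriv C = fun t => deriv C (t + T) := by
    funext s
    conv_lhs => rw [e]
    rw [deriv_comp_add_const]
  have d2 : deriv (deriv C) = fun t => deriv (deriv C) (t + T) := by
    funext s
    conv_lhs => rw [d1]
    rw [deriv_comp_add_const]
  have hd : DifferentiableAt ℝ (fun s => s + T) t := by fun_prop
  refine ⟨by rwa [← per], ?_, ?_, ?_, ?_⟩
  · rw [e]; exact a2.comp t hd
  · rw [d1]; exact a3
  · rw [d1]; exact a4.comp t hd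
  · rw [d2]; exact a5

lemma reg (S : AsymShape A B h T C) : ∃ M > 0, ∀ t, Reg C M t := by
  have hA := S.hA; have hB := S.hB; have h1 := S.h_pos; have h2 := S.hT_pos
  have hT := S.T_pos
  let M : ℝ := 1 + A / B + A + A * A + A * B
  have hM : M = 1 + A / B + A + A * A + A * B := rfl
  have q1 : 0 < A / B := div_pos hA hB
  have q2 : 0 < A * A := by positivity
  have q3 : 0 < A * B := by positivity
  let E : ℝ → ℝ := fun t => if t ≤ h then cos (A * t) else - (A / B) * sin (B * (t - h))
  let E' : ℝ → ℝ := fun t => if t ≤ h then - A * sin (A * t) else - A * cos (B * (t - h))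
  let E'' : ℝ → ℝ := fun t => if t ≤ h then - (A * A) * cos (A * t) else (A * B) * sin (B * (t - h))
  have dE : ∀ t, HasDerivAt E (E' t) t := by
    apply aux_glue
    · intro t
      have := ((hasDerivAt_id' t).const_mul A).cos
      exact this.congr_deriv (by ring)
    · intro t
      have := ((((hasDerivAt_id' t).sub_const h).const_mul B).sin).const_mul (-(A/B))
      exact this.congr_deriv (by field_simp)
    · simp [S.hh]
    · simp [S.hh]
  have dE' : ∀ t, HasDerivAt E' (E'' t) t := by
    apply aux_glue
    · intro t
      have := (((hasDerivAt_id' t).const_mul A).sin).const_mul (-A)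
      exact this.congr_deriv (by ring)
    · intro t
      have := ((((hasDerivAt_id' t).sub_const h).const_mul B).cos).const_mul (-A)
      exact this.congr_deriv (by ring)
    · simp [S.hh]
    · simp [S.hh]
  have hE1 : deriv E = E' := funext fun t => (dE t).deriv
  have hE2 : deriv E' = E'' := funext fun t => (dE' t).deriv
  have bd : ∀ c x : ℝ, 0 ≤ c → c ≤ M → |x| ≤ 1 → |c * x| ≤ M := by
    intro c x hc hcM hx
    rw [abs_mul, abs_of_nonneg hc]
    nlinarith
  have regE : ∀ t, Reg E M t := by
    intro t
    refine ⟨?_, (dE t).differentiableAt, ?_, ?_, ?_⟩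
    · simp only [E]; split_ifs
      · exact (abs_cos_le_one _).trans (by linarith)
      · rw [neg_mul, abs_neg]; exact bd _ _ q1.le (by linarith) (abs_sin_le_one _)
    · rw [hE1]; simp only [E']; split_ifs
      · rw [neg_mul, abs_neg]; exact bd _ _ hA.le (by linarith) (abs_sin_le_one _)
      · rw [neg_mul, abs_neg]; exact bd _ _ hA.le (by linarith) (abs_cos_le_one _)
    · rw [hE1]; exact (dE' t).differentiableAt
    · rw [hE1, hE2]; simp only [E'']; split_ifs
      · rw [neg_mul, abs_neg]; exact bd _ _ q2.le (by linarith) (abs_cos_le_one _)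
      · exact bd _ _ q3.le (by linarith) (abs_sin_le_one _)
  have r1 : ∀ t ∈ Set.Ioo (-h) (T - h), Reg C M t := by
    intro t ht
    refine reg_congr ?_ (regE t)
    filter_upwards [Ioo_mem_nhds ht.1 ht.2] with s hs
    simp only [E]; split_ifs with hsh
    · exact S.pos s ⟨hs.1.le, hsh⟩
    · exact S.neg s ⟨(not_le.1 hsh).le, hs.2.le⟩
  have r2 : ∀ t ∈ Set.Ico (-h) (T - h), Reg C M t := by
    intro t ht
    rcases eq_or_lt_of_le ht.1 with e | e
    · apply reg_neg S.even
      rw [← e, neg_neg]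
      exact r1 h ⟨by linarith, h2⟩
    · exact r1 t ⟨e, ht.2⟩
  refine ⟨M, by linarith, fun t => ?_⟩
  obtain ⟨k, hk, -⟩ := existsUnique_add_zsmul_mem_Ico hT t (-h)
  have hk' : t + k * T ∈ Set.Ico (-h) (T - h) := by
    simp only [zsmul_eq_mul] at hk
    exact ⟨hk.1, by linarith [hk.2]⟩
  have pk : ∀ t, C (t + k * T) = C t := by
    intro t
    have : Function.Periodic C T := S.per
    exact (this.int_mul k) t
  exact reg_add pk (r2 _ hk')

end AsymShape

/-- a two-valued sign -/
def sg (c : ℝ) : ℝ := if 0 < c then 1 else -1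

lemma sg_measurable : Measurable sg :=
  Measurable.ite measurableSet_Ioi measurable_const measurable_const

lemma sg_abs (c : ℝ) : |sg c| ≤ 1 := by
  unfold sg; split_ifs <;> simp

lemma per_shift {F : ℝ → ℝ} {T : ℝ} (n : ℕ) (hT : n * T = 2 * π) (hF : Function.Periodic F T)
    (hi : ∀ s t, IntervalIntegrable F volume s t) (y h : ℝ) :
    ∫ t in (0:ℝ)..(2 * π), F (y + t) = n * ∫ t in (-h)..(T - h), F t := by
  rw [intervalIntegral.integral_comp_add_left F y]
  have := hF.intervalIntegral_add_zsmul_eq (n : ℤ) y hi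
  simp only [zsmul_eq_mul, Int.cast_natCast, hT] at this
  rw [add_zero, this, hF.intervalIntegral_add_eq y (-h)]
  congr 2; ring

lemma integrable_sg {C G : ℝ → ℝ} (hC : Continuous C) (hG : Continuous G) (s t : ℝ) :
    IntervalIntegrable (fun u => G u * sg (C u)) volume s t := by
  rw [intervalIntegrable_iff]
  refine Integrable.mul_bdd (c := 1) ?_ ?_ ?_
  · exact intervalIntegrable_iff.1 (hG.intervalIntegrable s t)
  · exact (sg_measurable.comp hC.measurable).aestronglyMeasurable
  · exact Filter.Eventually.of_forall fun u => sg_abs _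

lemma sign_int {A B h T : ℝ} {C G : ℝ → ℝ} (S : AsymShape A B h T C) (hC : Continuous C)
    (n : ℕ) (hT : n * T = 2 * π) (hG : Continuous G) (hGp : ∀ t, G (t + T) = G t) (x y : ℝ) :
    ∫ t in (0:ℝ)..(2 * π), G (x + t) * sg (C (y + t)) =
      n * (2 * (∫ s in (-h)..h, G (s + (x - y))) - ∫ s in (-h)..(T - h), G s) := by
  have h1 := S.h_pos; have h2 := S.hT_pos
  let F : ℝ → ℝ := fun s => G (s + (x - y)) * sg (C s)
  have hGc : Continuous fun s => G (s + (x - y)) := by fun_prop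
  have hF : Function.Periodic F T := by
    intro s
    simp only [F]
    rw [S.per, show s + T + (x - y) = s + (x - y) + T by ring, hGp]
  have hi : ∀ s t, IntervalIntegrable F volume s t := integrable_sg hC hGc
  have e1 : ∫ t in (0:ℝ)..(2 * π), G (x + t) * sg (C (y + t)) = ∫ t in (0:ℝ)..(2 * π), F (y + t) := by
    congr 1; funext t; simp only [F]; congr 2; ring
  rw [e1, per_shift n hT hF hi y h]
  congr 1
  have i1 : ∫ t in (-h)..h, F t = ∫ s in (-h)..h, G (s + (x - y)) := by
    apply intervalIntegral.integral_congr_Ioo_of_le (by linarith)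
    intro t ht
    simp only [F, sg, if_pos (S.pos' t ht), mul_one]
  have i2 : ∫ t in h..(T - h), F t = - ∫ s in h..(T - h), G (s + (x - y)) := by
    rw [← intervalIntegral.integral_neg]
    apply intervalIntegral.integral_congr_Ioo_of_le (by linarith)
    intro t ht
    simp only [F, sg, if_neg (not_lt.2 (S.neg' t ht).le), mul_neg, mul_one]
  have e2 : ∫ s in (-h)..(T - h), G s = ∫ s in (-h)..(T - h), G (s + (x - y)) := by
    rw [intervalIntegral.integral_comp_add_right]
    have : Function.Periodic G T := hGp
    have := this.intervalIntegral_add_eq (-h) (-h + (x-y))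
    convert this using 2 <;> ring
  rw [e2, ← intervalIntegral.integral_add_adjacent_intervals (hi (-h) h) (hi h (T-h)), i1, i2,
    ← intervalIntegral.integral_add_adjacent_intervals (hGc.intervalIntegrable (-h) h)
      (hGc.intervalIntegrable h (T-h))]
  ring

lemma small_int {A B h T : ℝ} {C : ℝ → ℝ} (S : AsymShape A B h T C) (hC : Continuous C)
    (n : ℕ) (hT : n * T = 2 * π) {ε : ℝ} (hε : 0 < ε) :
    ∃ κ > 0, ∀ y, ∫ t in (0:ℝ)..(2 * π), κ / (κ + |C (y + t)|) ≤ ε := by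
  have h1 := S.h_pos; have h2 := S.hT_pos
  have hcont : ∀ κ > 0, Continuous fun t => κ / (κ + |C t|) := by
    intro κ hκ
    refine Continuous.div (by fun_prop) (by fun_prop) fun t => ?_
    have := abs_nonneg (C t); linarith
  have key : Tendsto (fun κ : ℝ => ∫ t in (-h)..(T - h), κ / (κ + |C t|)) (nhdsWithin 0 (Set.Ioi 0))
      (nhds (∫ t in (-h)..(T - h), (0:ℝ))) := by
    apply intervalIntegral.tendsto_integral_filter_of_dominated_convergence (fun _ => 1)
    · filter_upwards [self_mem_nhdsWithin] with κ hκ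
      exact (hcont κ hκ).aestronglyMeasurable
    · filter_upwards [self_mem_nhdsWithin] with κ hκ
      refine Filter.Eventually.of_forall fun t _ => ?_
      have hκ' : 0 < κ := hκ
      have := abs_nonneg (C t)
      rw [norm_of_nonneg (by positivity), div_le_one (by positivity)]
      linarith
    · exact intervalIntegrable_const
    · have hfin : ∀ᵐ t ∂(volume : Measure ℝ), t ≠ h ∧ t ≠ T - h := by
        have e1 : ∀ᵐ t ∂(volume : Measure ℝ), t ≠ h := by simp [ae_iff]
        have e2 : ∀ᵐ t ∂(volume : Measure ℝ), t ≠ T - h := by simp [ae_iff]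
        filter_upwards [e1, e2] with t a b using ⟨a, b⟩
      filter_upwards [hfin] with t ht hmem
      rw [Set.uIoc_of_le (by linarith)] at hmem
      have hne : C t ≠ 0 := by
        rcases lt_or_gt_of_ne ht.1 with q | q
        · exact (S.pos' t ⟨hmem.1, q⟩).ne'
        · exact (S.neg' t ⟨q, lt_of_le_of_ne hmem.2 ht.2⟩).ne
      have hp : 0 < |C t| := abs_pos.2 hne
      have hct : ContinuousAt (fun κ : ℝ => κ / (κ + |C t|)) 0 := by
        refine ContinuousAt.div (by fun_prop) (by fun_prop) ?_
        simpa using hne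
      have := hct.tendsto
      simp only [zero_div] at this
      exact this.mono_left nhdsWithin_le_nhds
  rw [intervalIntegral.integral_zero] at key
  have key2 := key.const_mul (n : ℝ)
  rw [mul_zero] at key2
  have ev := (key2.eventually (Iio_mem_nhds hε)).and self_mem_nhdsWithin
  obtain ⟨κ, hκ1, hκ2⟩ := ev.exists
  refine ⟨κ, hκ2, fun y => ?_⟩
  rw [per_shift (F := fun t => κ / (κ + |C t|)) n hT (fun t => by simp only [S.per])
    (fun s t => (hcont κ hκ2).intervalIntegrable s t) y h]
  exact le_of_lt hκ1

lemma phi_far {φ : ℝ → ℝ} {φinf : ℝ} (h1 : Tendsto φ atTop (nhds φinf))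
    (h2 : Tendsto φ atBot (nhds (-φinf))) {ε : ℝ} (hε : 0 < ε) :
    ∃ X > 0, (∀ z, X ≤ z → |φ z - φinf| ≤ ε) ∧ (∀ z, z ≤ -X → |φ z + φinf| ≤ ε) := by
  have e1 := h1.eventually (Metric.closedBall_mem_nhds φinf hε)
  have e2 := h2.eventually (Metric.closedBall_mem_nhds (-φinf) hε)
  obtain ⟨X1, hX1⟩ := eventually_atTop.1 e1
  obtain ⟨X2, hX2⟩ := eventually_atBot.1 e2
  refine ⟨max 1 (max X1 (-X2)), by positivity, fun z hz => ?_, fun z hz => ?_⟩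
  · have := hX1 z (le_trans (le_trans (le_max_left _ _) (le_max_right _ _)) hz)
    simpa [Real.dist_eq] using this
  · have h3 : -X2 ≤ max 1 (max X1 (-X2)) := le_trans (le_max_right _ _) (le_max_right _ _)
    have := hX2 z (by linarith)
    simpa [Real.dist_eq] using this

lemma phi_pt {φ : ℝ → ℝ} {φinf P ε κ X γ ρ c c' : ℝ} (hP : 0 ≤ P) (hφ : ∀ x, |φ x| ≤ P)
    (hinf : |φinf| ≤ P) (hε : 0 ≤ ε) (hκ : 0 < κ) (hγ : 0 < γ)
    (hX1 : ∀ z, X ≤ z → |φ z - φinf| ≤ ε) (hX2 : ∀ z, z ≤ -X → |φ z + φinf| ≤ ε)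
    (hX : 0 < X) (hρ : 2 * X / (γ * κ) ≤ ρ) (hc : |c' - c| ≤ κ / 2) :
    |φ (γ * ρ * c') - φinf * sg c| ≤ ε + 4 * P * (κ / (κ + |c|)) := by
  have hγκ : 0 < γ * κ := by positivity
  rw [div_le_iff₀ hγκ] at hρ
  have hρ0 : 0 < γ * ρ := by
    have : 0 < ρ := by
      by_contra hh
      nlinarith
    positivity
  have hc0 := abs_nonneg c
  have hnn : 0 ≤ 4 * P * (κ / (κ + |c|)) := by positivity
  have hb := abs_le.1 hc
  rcases lt_or_ge |c| κ with h | h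
  · have h1 : 1 / 2 ≤ κ / (κ + |c|) := by
      rw [div_le_div_iff₀ (by norm_num) (by positivity)]; linarith
    have h2 : |φ (γ * ρ * c') - φinf * sg c| ≤ 2 * P := by
      refine (abs_sub _ _).trans ?_
      have : |φinf * sg c| ≤ P := by
        rw [abs_mul]
        have := sg_abs c
        have := abs_nonneg φinf
        nlinarith [abs_nonneg (sg c)]
      linarith [hφ (γ * ρ * c')]
    nlinarith
  · rcases le_total 0 c with hs | hs
    · rw [abs_of_nonneg hs] at h
      have : sg c = 1 := if_pos (by linarith)
      rw [this, mul_one]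
      have : X ≤ γ * ρ * c' := by nlinarith
      linarith [hX1 _ this]
    · rw [abs_of_nonpos hs] at h
      have : sg c = -1 := if_neg (by linarith)
      rw [this, mul_neg, mul_one, sub_neg_eq_add]
      have : γ * ρ * c' ≤ -X := by nlinarith
      linarith [hX2 _ this]

lemma key {A B h T : ℝ} {C G p φ : ℝ → ℝ} {φinf M P γ : ℝ} (S : AsymShape A B h T C)
    (n : ℕ) (hT : n * T = 2 * π) (hM : 0 < M) (hP : 0 < P)
    (hC : Continuous C) (hCL : ∀ x y, |C x - C y| ≤ M * |x - y|)
    (hG : Continuous G) (hGL : ∀ x y, |G x - G y| ≤ M * |x - y|) (hGb : ∀ x, |G x| ≤ M)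
    (hp : Continuous p) (hpb : ∀ t ∈ Set.Icc (0:ℝ) (2 * π), |p t| ≤ P)
    (hφ : Continuous φ) (hφb : ∀ t, |φ t| ≤ P)
    (htop : Tendsto φ atTop (nhds φinf)) (hbot : Tendsto φ atBot (nhds (-φinf)))
    (hγ : 0 < γ) {ε : ℝ} (hε : 0 < ε) :
    ∃ η > 0, ∃ R > 0, ∀ (x y : ℝ) (u v w ρ : ℝ → ℝ),
      ContinuousOn u (Set.Icc 0 (2 * π)) → ContinuousOn v (Set.Icc 0 (2 * π)) →
      ContinuousOn w (Set.Icc 0 (2 * π)) → ContinuousOn ρ (Set.Icc 0 (2 * π)) →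
      (∀ t ∈ Set.Icc 0 (2 * π), |u t - (x + t)| ≤ η ∧ |v t - (y + t)| ≤ η ∧ |w t - 1| ≤ η ∧ R ≤ ρ t) →
      |(∫ t in (0:ℝ)..(2 * π), w t * (G (u t) * (p t - φ (γ * ρ t * C (v t))))) -
        ((∫ t in (0:ℝ)..(2 * π), G (x + t) * p t) -
          φinf * ∫ t in (0:ℝ)..(2 * π), G (x + t) * sg (C (y + t)))| ≤ ε := by
  have hpi := pi_pos
  have h2pi : (0:ℝ) ≤ 2 * π := by positivity
  have hinf : |φinf| ≤ P := le_of_tendsto htop.abs (Filter.Eventually.of_forall hφb)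
  set ε' := ε / (8 * π * M) with hε'
  have hε'0 : 0 < ε' := by positivity
  obtain ⟨X, hX, hX1, hX2⟩ := phi_far htop hbot hε'0
  obtain ⟨κ, hκ, hκi⟩ := small_int S hC n hT (show 0 < ε / (16 * M * P) by positivity)
  refine ⟨min (ε / (32 * π * M * P)) (κ / (2 * M)), by positivity, 2 * X / (γ * κ), by positivity, ?_⟩
  intro x y u v w ρ hu hv hw hρ H
  set η := min (ε / (32 * π * M * P)) (κ / (2 * M)) with hη
  have hη0 : 0 < η := by positivity
  have hη1 : η ≤ ε / (32 * π * M * P) := min_le_left _ _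
  have hη2 : M * η ≤ κ / 2 := by
    have : η ≤ κ / (2 * M) := min_le_right _ _
    rw [le_div_iff₀ (by positivity)] at this
    linarith
  have hGx : Continuous fun t => G (x + t) := by fun_prop
  have hCy : Continuous fun t => C (y + t) := by fun_prop
  have i1 : IntervalIntegrable (fun t => w t * (G (u t) * (p t - φ (γ * ρ t * C (v t))))) volume 0 (2*π) := by
    apply ContinuousOn.intervalIntegrable
    rw [Set.uIcc_of_le h2pi]
    refine hw.mul ((hG.comp_continuousOn hu).mul (hp.continuousOn.sub (hφ.comp_continuousOn ?_)))
    exact (continuousOn_const.mul hρ).mul (hC.comp_continuousOn hv)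
  have i2 : IntervalIntegrable (fun t => G (x + t) * p t) volume 0 (2*π) :=
    (hGx.mul hp).intervalIntegrable _ _
  have i3 : IntervalIntegrable (fun t => G (x + t) * sg (C (y + t))) volume 0 (2*π) :=
    integrable_sg hCy hGx _ _
  rw [← intervalIntegral.integral_const_mul, ← intervalIntegral.integral_sub i2 (i3.const_mul _),
    ← intervalIntegral.integral_sub i1 (i2.sub (i3.const_mul _))]
  have hκc : Continuous fun t => κ / (κ + |C (y + t)|) := by
    refine Continuous.div (by fun_prop) (by fun_prop) fun t => ?_
    have := abs_nonneg (C (y + t)); linarith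
  let g : ℝ → ℝ := fun t => (4 * M * P * η + M * ε') + 4 * M * P * (κ / (κ + |C (y + t)|))
  have hg : IntervalIntegrable g volume 0 (2*π) :=
    (continuous_const.add (continuous_const.mul hκc)).intervalIntegrable _ _
  have hb : ∀ t ∈ Set.Ioc 0 (2*π), ‖w t * (G (u t) * (p t - φ (γ * ρ t * C (v t)))) -
      (G (x + t) * p t - φinf * (G (x + t) * sg (C (y + t))))‖ ≤ g t := by
    intro t ht
    have ht' : t ∈ Set.Icc 0 (2*π) := ⟨ht.1.le, ht.2⟩
    obtain ⟨a1, a2, a3, a4⟩ := H t ht'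
    have b1 : |C (v t) - C (y + t)| ≤ κ / 2 := by
      refine (hCL _ _).trans (le_trans ?_ hη2)
      gcongr
    have b2 := phi_pt hP.le hφb hinf hε'0.le hκ hγ hX1 hX2 hX a4 b1
    set q := φ (γ * ρ t * C (v t)) with hq
    have b3 : |p t - q| ≤ 2 * P := by
      refine (abs_sub _ _).trans ?_
      linarith [hpb t ht', hφb (γ * ρ t * C (v t))]
    have b4 : |G (u t) - G (x + t)| ≤ M * η := by
      refine (hGL _ _).trans ?_
      gcongr
    have e : w t * (G (u t) * (p t - q)) - (G (x + t) * p t - φinf * (G (x + t) * sg (C (y + t)))) =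
      (w t - 1) * G (u t) * (p t - q) + (G (u t) - G (x + t)) * (p t - q)
        - G (x + t) * (q - φinf * sg (C (y + t))) := by ring
    rw [e, Real.norm_eq_abs]
    have c1 : |(w t - 1) * G (u t) * (p t - q)| ≤ η * M * (2 * P) := by
      rw [abs_mul, abs_mul]; gcongr; exact hGb _
    have c2 : |(G (u t) - G (x + t)) * (p t - q)| ≤ M * η * (2 * P) := by
      rw [abs_mul]; gcongr
    have c3 : |G (x + t) * (q - φinf * sg (C (y + t)))| ≤ M * (ε' + 4 * P * (κ / (κ + |C (y + t)|))) := by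
      rw [abs_mul]; gcongr; exact hGb _
    refine (abs_sub _ _).trans ((add_le_add ((abs_add_le _ _).trans (add_le_add c1 c2)) c3).trans (le_of_eq ?_))
    simp only [g]; ring
  have := intervalIntegral.norm_integral_le_of_norm_le h2pi (Filter.Eventually.of_forall hb) hg
  rw [Real.norm_eq_abs] at this
  refine this.trans ?_
  simp only [g]
  rw [intervalIntegral.integral_add intervalIntegrable_const
    ((hκc.intervalIntegrable _ _).const_mul _), intervalIntegral.integral_const,
    intervalIntegral.integral_const_mul, smul_eq_mul]
  have k1 : 4 * M * P * (∫ t in (0:ℝ)..(2 * π), κ / (κ + |C (y + t)|)) ≤ ε / 4 := by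
    calc _ ≤ 4 * M * P * (ε / (16 * M * P)) := by gcongr; exact hκi y
      _ = ε / 4 := by field_simp; norm_num
  have k2 : 2 * π * (4 * M * P * η) ≤ ε / 4 := by
    calc _ ≤ 2 * π * (4 * M * P * (ε / (32 * π * M * P))) := by gcongr
      _ = ε / 4 := by field_simp; norm_num
  have k3 : 2 * π * (M * ε') = ε / 4 := by rw [hε']; field_simp; norm_num
  linarith

/-- solution of the system, with positive radii -/
def Sol (n : ℕ) (γ₁ γ₂ : ℝ) (C₁ C₂ p₁ p₂ φ₁ φ₂ θ₁ θ₂ r₁ r₂ : ℝ → ℝ) : Prop :=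
  ∀ t ∈ Set.Icc (0 : ℝ) (2 * π),
            0 < r₁ t ∧ 0 < r₂ t ∧
            HasDerivAt θ₁ ((n : ℝ) - γ₁ / (2 * r₁ t) * C₁ (θ₁ t / n) *
              (p₁ t - φ₁ (γ₂ * r₂ t * C₂ (θ₂ t / n)))) t ∧
            HasDerivAt θ₂ ((n : ℝ) - γ₂ / (2 * r₂ t) * C₂ (θ₂ t / n) *
              (p₂ t - φ₂ (γ₁ * r₁ t * C₁ (θ₁ t / n)))) t ∧
            HasDerivAt r₁ (γ₁ / (2 * n) * deriv C₁ (θ₁ t / n) *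
              (p₁ t - φ₁ (γ₂ * r₂ t * C₂ (θ₂ t / n)))) t ∧
            HasDerivAt r₂ (γ₂ / (2 * n) * deriv C₂ (θ₂ t / n) *
              (p₂ t - φ₂ (γ₁ * r₁ t * C₁ (θ₁ t / n)))) t

lemma Sol.swap {n : ℕ} {γ₁ γ₂ : ℝ} {C₁ C₂ p₁ p₂ φ₁ φ₂ θ₁ θ₂ r₁ r₂ : ℝ → ℝ}
    (H : Sol n γ₁ γ₂ C₁ C₂ p₁ p₂ φ₁ φ₂ θ₁ θ₂ r₁ r₂) :
    Sol n γ₂ γ₁ C₂ C₁ p₂ p₁ φ₂ φ₁ θ₂ θ₁ r₂ r₁ := by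
  intro t ht
  obtain ⟨a, b, c, d, e, f⟩ := H t ht
  exact ⟨b, a, d, c, f, e⟩

lemma mvt_bd {f f' : ℝ → ℝ} {N : ℝ} (hN : 0 ≤ N)
    (hf : ∀ t ∈ Set.Icc (0 : ℝ) (2 * π), HasDerivAt f (f' t) t)
    (hb : ∀ t ∈ Set.Icc (0 : ℝ) (2 * π), |f' t| ≤ N) :
    ∀ t ∈ Set.Icc (0 : ℝ) (2 * π), |f t - f 0| ≤ 2 * π * N := by
  intro t ht
  have h0 : (0:ℝ) ∈ Set.Icc (0 : ℝ) (2 * π) := ⟨le_rfl, by have := pi_pos; positivity⟩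
  have := Convex.norm_image_sub_le_of_norm_hasDerivWithin_le (f := f) (f' := f')
    (fun x hx => (hf x hx).hasDerivWithinAt) hb (convex_Icc _ _) h0 ht
  rw [Real.norm_eq_abs, Real.norm_eq_abs, sub_zero, abs_of_nonneg ht.1] at this
  nlinarith [ht.2]

/-- a priori bounds for one of the two components -/
lemma apriori {n : ℕ} (hn : 1 ≤ n) {γ M P μ : ℝ} {C p q θ r : ℝ → ℝ} (hγ : 0 < γ) (hM : 0 < M)
    (hP : 0 < P)
    (hreg : ∀ t, AsymShape.Reg C M t)
    (hpb : ∀ t ∈ Set.Icc (0:ℝ) (2 * π), |p t| ≤ P) (hq : ∀ t, |q t| ≤ P)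
    (hμ : 0 < μ) (hr0 : μ + 2 * π * (γ * M * P) ≤ r 0)
    (hr : ∀ t ∈ Set.Icc (0:ℝ) (2 * π), HasDerivAt r (γ / (2 * n) * deriv C (θ t / n) * (p t - q t)) t)
    (hθ : ∀ t ∈ Set.Icc (0:ℝ) (2 * π),
      HasDerivAt θ ((n : ℝ) - γ / (2 * r t) * C (θ t / n) * (p t - q t)) t) :
    ∀ t ∈ Set.Icc (0:ℝ) (2 * π), μ ≤ r t ∧ |θ t / n - (θ 0 / n + t)| ≤ 2 * π * (γ * M * P) / μ ∧
      |r 0 / r t - 1| ≤ 2 * π * (γ * M * P) / μ := by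
  have hn1 : (1 : ℝ) ≤ n := by exact_mod_cast hn
  have hpi := pi_pos
  have hpq : ∀ t ∈ Set.Icc (0:ℝ) (2 * π), |p t - q t| ≤ 2 * P := by
    intro t ht
    refine (abs_sub _ _).trans ?_
    linarith [hpb t ht, hq t]
  have b1 : ∀ t ∈ Set.Icc (0:ℝ) (2 * π), |r t - r 0| ≤ 2 * π * (γ * M * P) := by
    refine mvt_bd (by positivity) hr fun t ht => ?_
    have h1 := (hreg (θ t / n)).2.2.1
    have h2 := hpq t ht
    rw [abs_mul, abs_mul, abs_of_pos (show 0 < γ / (2 * n) by positivity)]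
    calc γ / (2 * n) * |deriv C (θ t / n)| * |p t - q t| ≤ γ / (2 * 1) * M * (2 * P) := by gcongr
      _ = γ * M * P := by ring
  have b2 : ∀ t ∈ Set.Icc (0:ℝ) (2 * π), μ ≤ r t := by
    intro t ht
    have := abs_le.1 (b1 t ht)
    linarith [this.1]
  have b3 : ∀ t ∈ Set.Icc (0:ℝ) (2 * π), |(θ t - n * t) - (θ 0 - n * 0)| ≤ 2 * π * (γ * M * P / μ) := by
    have hd : ∀ t ∈ Set.Icc (0:ℝ) (2 * π), HasDerivAt (fun t => θ t - n * t)
        (- (γ / (2 * r t) * C (θ t / n) * (p t - q t))) t := by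
      intro t ht
      exact ((hθ t ht).sub ((hasDerivAt_id' t).const_mul (n:ℝ))).congr_deriv (by ring)
    refine mvt_bd (by positivity) hd fun t ht => ?_
    have h1 := (hreg (θ t / n)).1
    have h2 := hpq t ht
    have h3 := b2 t ht
    have h4 : 0 < r t := by linarith
    rw [abs_neg, abs_mul, abs_mul, abs_of_pos (show 0 < γ / (2 * r t) by positivity)]
    calc γ / (2 * r t) * |C (θ t / n)| * |p t - q t| ≤ γ / (2 * μ) * M * (2 * P) := by gcongr
      _ = γ * M * P / μ := by field_simp
  intro t ht
  have h3 := b2 t ht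
  have h4 : 0 < r t := by linarith
  refine ⟨h3, ?_, ?_⟩
  · have := b3 t ht
    have e : θ t / n - (θ 0 / n + t) = ((θ t - n * t) - (θ 0 - n * 0)) / n := by field_simp; ring
    rw [e, abs_div, abs_of_pos (by linarith : (0:ℝ) < n)]
    refine (div_le_self (abs_nonneg _) hn1).trans (this.trans (le_of_eq ?_))
    ring
  · have e : r 0 / r t - 1 = (r 0 - r t) / r t := by field_simp
    rw [e, abs_div, abs_of_pos h4, abs_sub_comm]
    exact div_le_div₀ (by positivity) (b1 t ht) hμ h3

lemma lip_of_deriv {f : ℝ → ℝ} {M : ℝ} (h1 : ∀ t, DifferentiableAt ℝ f t) (h2 : ∀ t, |deriv f t| ≤ M)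
    (x y : ℝ) : |f x - f y| ≤ M * |x - y| := by
  have := Convex.norm_image_sub_le_of_norm_deriv_le (s := Set.univ) (f := f) (fun t _ => h1 t)
    (fun t _ => h2 t) convex_univ (Set.mem_univ y) (Set.mem_univ x)
  simpa using this

lemma half {n : ℕ} (hn : 1 ≤ n) {A₁ B₁ h₁ A₂ B₂ h₂ T : ℝ} {C₁ C₂ : ℝ → ℝ}
    (S₁ : AsymShape A₁ B₁ h₁ T C₁) (S₂ : AsymShape A₂ B₂ h₂ T C₂) (hT : n * T = 2 * π)
    {M P γ₁ γ₂ : ℝ} (hM : 0 < M) (hP : 0 < P) (hγ₁ : 0 < γ₁) (hγ₂ : 0 < γ₂)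
    (hreg₁ : ∀ t, AsymShape.Reg C₁ M t) (hreg₂ : ∀ t, AsymShape.Reg C₂ M t)
    {p₁ p₂ φ₁ φ₂ : ℝ → ℝ} (hp₁ : Continuous p₁)
    (hpb₁ : ∀ t ∈ Set.Icc (0:ℝ) (2 * π), |p₁ t| ≤ P) (hpb₂ : ∀ t ∈ Set.Icc (0:ℝ) (2 * π), |p₂ t| ≤ P)
    (hφ : Continuous φ₁) (hφb₁ : ∀ t, |φ₁ t| ≤ P) (hφb₂ : ∀ t, |φ₂ t| ≤ P) {φinf : ℝ}
    (htop : Tendsto φ₁ atTop (nhds φinf)) (hbot : Tendsto φ₁ atBot (nhds (-φinf)))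
    {δ : ℝ} (hδ : 0 < δ) :
    ∃ R₀ > 0, ∀ R ≥ R₀, ∀ θ₁ θ₂ r₁ r₂ : ℝ → ℝ, R ≤ r₁ 0 → R ≤ r₂ 0 →
      Sol n γ₁ γ₂ C₁ C₂ p₁ p₂ φ₁ φ₂ θ₁ θ₂ r₁ r₂ →
      |r₁ (2 * π) - r₁ 0 + (-(γ₁ / 2) * (1 / n * ∫ t in (0:ℝ)..(2 * π), deriv C₁ (θ₁ 0 / n + t) * p₁ t)
        + γ₁ * n * φinf * (1 / n * (C₁ ((θ₁ 0 - θ₂ 0) / n + h₂) - C₁ ((θ₁ 0 - θ₂ 0) / n - h₂))))| ≤ δ ∧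
      |r₁ 0 * (θ₁ (2 * π) - θ₁ 0 - 2 * π * n) -
        (-(γ₁ / 2) * (∫ t in (0:ℝ)..(2 * π), C₁ (θ₁ 0 / n + t) * p₁ t) +
          γ₁ * n * φinf * ((∫ s in ((θ₁ 0 - θ₂ 0) / n - h₂)..((θ₁ 0 - θ₂ 0) / n + h₂), C₁ s) -
            (1 / A₁ - A₁ / B₁ ^ 2)))| ≤ δ := by
  have hpi := pi_pos
  have h2pi : (0:ℝ) ≤ 2 * π := by positivity
  have hn1 : (1 : ℝ) ≤ n := by exact_mod_cast hn
  have hn0 : (0 : ℝ) < n := by linarith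
  have dC₁ : Differentiable ℝ C₁ := fun t => (hreg₁ t).2.1
  have dC₂ : Differentiable ℝ C₂ := fun t => (hreg₂ t).2.1
  have dD₁ : Differentiable ℝ (deriv C₁) := fun t => (hreg₁ t).2.2.2.1
  have L₁ := lip_of_deriv dC₁ (fun t => (hreg₁ t).2.2.1)
  have L₂ := lip_of_deriv dC₂ (fun t => (hreg₂ t).2.2.1)
  have LD := lip_of_deriv dD₁ (fun t => (hreg₁ t).2.2.2.2)
  have perD : ∀ t, deriv C₁ (t + T) = deriv C₁ t := by
    intro t
    rw [← deriv_comp_add_const]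
    congr 1; funext s; exact S₁.per s
  have hε : 0 < δ / γ₁ := by positivity
  obtain ⟨η₁, hη₁, R₁, hR₁, key₁⟩ := key (G := C₁) S₂ n hT hM hP dC₂.continuous L₂ dC₁.continuous L₁
    (fun t => (hreg₁ t).1) hp₁ hpb₁ hφ hφb₁ htop hbot hγ₂ hε
  obtain ⟨η₂, hη₂, R₂, hR₂, key₂⟩ := key (G := deriv C₁) S₂ n hT hM hP dC₂.continuous L₂ dD₁.continuous LD
    (fun t => (hreg₁ t).2.2.1) hp₁ hpb₁ hφ hφb₁ htop hbot hγ₂ hε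
  set Z := 2 * π * ((γ₁ + γ₂) * M * P) with hZ
  have hZ0 : 0 < Z := by positivity
  set μ := R₁ + R₂ + Z / η₁ + Z / η₂ with hμ
  have q1 : 0 < Z / η₁ := by positivity
  have q2 : 0 < Z / η₂ := by positivity
  have hμ0 : 0 < μ := by positivity
  refine ⟨μ + Z, by positivity, ?_⟩
  intro R hR θ₁ θ₂ r₁ r₂ hr₁ hr₂ H
  have hZ₁ : 2 * π * (γ₁ * M * P) ≤ Z := by rw [hZ]; gcongr; linarith
  have hZ₂ : 2 * π * (γ₂ * M * P) ≤ Z := by rw [hZ]; gcongr; linarith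
  have ap₁ := apriori (r := r₁) (θ := θ₁) (q := fun t => φ₁ (γ₂ * r₂ t * C₂ (θ₂ t / n))) hn hγ₁ hM hP
    hreg₁ hpb₁ (fun t => hφb₁ _) hμ0 (by linarith) (fun t ht => (H t ht).2.2.2.2.1)
    (fun t ht => (H t ht).2.2.1)
  have ap₂ := apriori (r := r₂) (θ := θ₂) (q := fun t => φ₂ (γ₁ * r₁ t * C₁ (θ₁ t / n))) hn hγ₂ hM hP
    hreg₂ hpb₂ (fun t => hφb₂ _) hμ0 (by linarith) (fun t ht => (H t ht).2.2.2.2.2)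
    (fun t ht => (H t ht).2.2.2.1)
  have hZμ₁ : Z / μ ≤ η₁ := by
    rw [div_le_iff₀ hμ0]
    have : Z / η₁ * η₁ = Z := by field_simp
    nlinarith
  have hZμ₂ : Z / μ ≤ η₂ := by
    rw [div_le_iff₀ hμ0]
    have : Z / η₂ * η₂ = Z := by field_simp
    nlinarith
  have z₁ : 2 * π * (γ₁ * M * P) / μ ≤ Z / μ := by gcongr
  have z₂ : 2 * π * (γ₂ * M * P) / μ ≤ Z / μ := by gcongr
  have cθ₁ : ContinuousOn (fun t => θ₁ t / n) (Set.Icc 0 (2*π)) :=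
    ContinuousOn.div_const (fun t ht => (H t ht).2.2.1.continuousAt.continuousWithinAt) _
  have cθ₂ : ContinuousOn (fun t => θ₂ t / n) (Set.Icc 0 (2*π)) :=
    ContinuousOn.div_const (fun t ht => (H t ht).2.2.2.1.continuousAt.continuousWithinAt) _
  have cr₁ : ContinuousOn r₁ (Set.Icc 0 (2*π)) :=
    fun t ht => (H t ht).2.2.2.2.1.continuousAt.continuousWithinAt
  have cr₂ : ContinuousOn r₂ (Set.Icc 0 (2*π)) :=
    fun t ht => (H t ht).2.2.2.2.2.continuousAt.continuousWithinAt
  have cw : ContinuousOn (fun t => r₁ 0 / r₁ t) (Set.Icc 0 (2*π)) :=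
    continuousOn_const.div cr₁ fun t ht => (H t ht).1.ne'
  have cq : ContinuousOn (fun t => p₁ t - φ₁ (γ₂ * r₂ t * C₂ (θ₂ t / n))) (Set.Icc 0 (2*π)) :=
    hp₁.continuousOn.sub (hφ.comp_continuousOn
      ((continuousOn_const.mul cr₂).mul (dC₂.continuous.comp_continuousOn cθ₂)))
  have k₁ := key₁ (θ₁ 0 / n) (θ₂ 0 / n) (fun t => θ₁ t / n) (fun t => θ₂ t / n) (fun t => r₁ 0 / r₁ t) r₂
    cθ₁ cθ₂ cw cr₂ (fun t ht => ⟨by linarith [(ap₁ t ht).2.1], by linarith [(ap₂ t ht).2.1],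
      by linarith [(ap₁ t ht).2.2], by linarith [(ap₂ t ht).1]⟩)
  have k₂ := key₂ (θ₁ 0 / n) (θ₂ 0 / n) (fun t => θ₁ t / n) (fun t => θ₂ t / n) (fun t => 1) r₂
    cθ₁ cθ₂ continuousOn_const cr₂ (fun t ht => ⟨by linarith [(ap₁ t ht).2.1], by linarith [(ap₂ t ht).2.1],
      by simpa using hη₂.le, by linarith [(ap₂ t ht).1]⟩)
  rw [sign_int S₂ dC₂.continuous n hT dC₁.continuous S₁.per] at k₁
  rw [sign_int S₂ dC₂.continuous n hT dD₁.continuous perD] at k₂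
  have j1 : ∫ s in (-h₂)..(T - h₂), C₁ s = 2 * (1 / A₁ - A₁ / B₁ ^ 2) := by
    rw [← S₁.integral dC₁.continuous]
    have : Function.Periodic C₁ T := S₁.per
    have := this.intervalIntegral_add_eq (-h₂) (-h₁)
    convert this using 2 <;> ring
  have j2 : ∫ s in (-h₂)..(T - h₂), deriv C₁ s = 0 := by
    rw [intervalIntegral.integral_deriv_eq_sub (fun t _ => dC₁ t) (dD₁.continuous.intervalIntegrable _ _)]
    rw [show T - h₂ = -h₂ + T by ring, S₁.per, sub_self]
  have ed : θ₁ 0 / n - θ₂ 0 / n = (θ₁ 0 - θ₂ 0) / n := by ring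
  have j3 : ∫ s in (-h₂)..h₂, C₁ (s + (θ₁ 0 / n - θ₂ 0 / n)) =
      ∫ s in ((θ₁ 0 - θ₂ 0) / n - h₂)..((θ₁ 0 - θ₂ 0) / n + h₂), C₁ s := by
    rw [intervalIntegral.integral_comp_add_right, ed]
    congr 1 <;> ring
  have j4 : ∫ s in (-h₂)..h₂, deriv C₁ (s + (θ₁ 0 / n - θ₂ 0 / n)) =
      C₁ ((θ₁ 0 - θ₂ 0) / n + h₂) - C₁ ((θ₁ 0 - θ₂ 0) / n - h₂) := by
    rw [intervalIntegral.integral_comp_add_right (fun s => deriv C₁ s), ed,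
      intervalIntegral.integral_deriv_eq_sub (fun t _ => dC₁ t) (dD₁.continuous.intervalIntegrable _ _)]
    congr 2 <;> ring
  rw [j1, j3] at k₁
  rw [j2, j4] at k₂
  have v₁ : r₁ 0 * (θ₁ (2 * π) - θ₁ 0 - 2 * π * n) = -(γ₁ / 2) *
      ∫ t in (0:ℝ)..(2 * π), r₁ 0 / r₁ t * (C₁ (θ₁ t / n) * (p₁ t - φ₁ (γ₂ * r₂ t * C₂ (θ₂ t / n)))) := by
    have hd : ∀ t ∈ Set.uIcc (0:ℝ) (2 * π), HasDerivAt (fun t => r₁ 0 * (θ₁ t - n * t))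
        (-(γ₁ / 2) * (r₁ 0 / r₁ t * (C₁ (θ₁ t / n) * (p₁ t - φ₁ (γ₂ * r₂ t * C₂ (θ₂ t / n)))))) t := by
      intro t ht
      rw [Set.uIcc_of_le h2pi] at ht
      have hrt := (H t ht).1
      exact (((H t ht).2.2.1.sub ((hasDerivAt_id' t).const_mul (n:ℝ))).const_mul (r₁ 0)).congr_deriv
        (by field_simp; ring)
    have := intervalIntegral.integral_eq_sub_of_hasDerivAt hd (by
      apply ContinuousOn.intervalIntegrable
      rw [Set.uIcc_of_le h2pi]
      exact continuousOn_const.mul (cw.mul ((dC₁.continuous.comp_continuousOn cθ₁).mul cq)))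
    rw [intervalIntegral.integral_const_mul] at this
    rw [this]; ring
  have v₂ : r₁ (2 * π) - r₁ 0 = (γ₁ / (2 * n)) *
      ∫ t in (0:ℝ)..(2 * π), 1 * (deriv C₁ (θ₁ t / n) * (p₁ t - φ₁ (γ₂ * r₂ t * C₂ (θ₂ t / n)))) := by
    have hd : ∀ t ∈ Set.uIcc (0:ℝ) (2 * π), HasDerivAt r₁
        ((γ₁ / (2 * n)) * (1 * (deriv C₁ (θ₁ t / n) * (p₁ t - φ₁ (γ₂ * r₂ t * C₂ (θ₂ t / n)))))) t := by
      intro t ht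
      rw [Set.uIcc_of_le h2pi] at ht
      exact ((H t ht).2.2.2.2.1).congr_deriv (by ring)
    have := intervalIntegral.integral_eq_sub_of_hasDerivAt hd (by
      apply ContinuousOn.intervalIntegrable
      rw [Set.uIcc_of_le h2pi]
      exact continuousOn_const.mul (continuousOn_const.mul ((dD₁.continuous.comp_continuousOn cθ₁).mul cq)))
    rw [intervalIntegral.integral_const_mul] at this
    rw [this]
  constructor
  · rw [v₂]
    have e : ∀ I J c : ℝ, γ₁ / (2 * n) * I + (-(γ₁ / 2) * (1 / n * J) + γ₁ * n * φinf * (1 / n * c)) =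
        γ₁ / (2 * n) * (I - (J - φinf * (n * (2 * c - 0)))) := by
      intro I J c; field_simp; ring
    rw [e, abs_mul, abs_of_pos (by positivity)]
    calc _ ≤ γ₁ / (2 * n) * (δ / γ₁) := by gcongr
      _ ≤ γ₁ / (1 * 1) * (δ / γ₁) := by gcongr; norm_num
      _ = δ := by field_simp
  · rw [v₁]
    have e : ∀ I J c d : ℝ, -(γ₁ / 2) * I - (-(γ₁ / 2) * J + γ₁ * n * φinf * (c - d)) =
        -((γ₁ / 2) * (I - (J - φinf * (n * (2 * c - 2 * d))))) := by
      intro I J c d; ring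
    rw [e, abs_neg, abs_mul, abs_of_pos (by positivity)]
    calc _ ≤ γ₁ / 2 * (δ / γ₁) := by gcongr
      _ ≤ γ₁ / 1 * (δ / γ₁) := by gcongr; norm_num
      _ = δ := by field_simp

section existence

variable {X : Type*} [PseudoMetricSpace X]

lemma ll_mul {f g : X → ℝ} (hf : LocallyLipschitz f) (hg : LocallyLipschitz g) :
    LocallyLipschitz fun x => f x * g x := by
  have : LocallyLipschitz (fun q : ℝ × ℝ => q.1 * q.2) :=
    ContDiff.locallyLipschitz (𝕂 := ℝ) (by fun_prop)
  exact this.comp (hf.prodMk hg)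

lemma ll_sub {f g : X → ℝ} (hf : LocallyLipschitz f) (hg : LocallyLipschitz g) :
    LocallyLipschitz fun x => f x - g x := by
  have : LocallyLipschitz (fun q : ℝ × ℝ => q.1 - q.2) :=
    ContDiff.locallyLipschitz (𝕂 := ℝ) (by fun_prop)
  exact this.comp (hf.prodMk hg)

/-- truncated inverse -/
def tinv (r : ℝ) : ℝ := (max r 1)⁻¹

lemma tinv_ll : LocallyLipschitz tinv := by
  have : LipschitzWith 1 tinv := by
    apply LipschitzWith.of_dist_le_mul
    intro x y
    rw [Real.dist_eq, Real.dist_eq]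
    unfold tinv
    have hx : 1 ≤ max x 1 := le_max_right _ _
    have hy : 1 ≤ max y 1 := le_max_right _ _
    have h1 : (max x 1)⁻¹ - (max y 1)⁻¹ = (max y 1 - max x 1) / (max x 1 * max y 1) := by
      field_simp
    rw [h1, abs_div, abs_of_pos (show 0 < max x 1 * max y 1 by positivity)]
    have h2 : |max y 1 - max x 1| ≤ |x - y| := by
      rw [abs_sub_comm x y]; exact abs_max_sub_max_le_abs _ _ _
    refine (div_le_self (abs_nonneg _) (by nlinarith)).trans ?_
    simpa using h2
  exact this.locallyLipschitz

lemma tinv_abs (r : ℝ) : |tinv r| ≤ 1 := by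
  unfold tinv
  have h : 1 ≤ max r 1 := le_max_right _ _
  rw [abs_of_pos (by positivity)]
  exact inv_le_one_of_one_le₀ h

lemma tinv_eq {r : ℝ} (h : 1 ≤ r) : tinv r = r⁻¹ := by
  unfold tinv; rw [max_eq_left h]

/-- angular part of the truncated field -/
def vθ (n : ℕ) (γ γ' : ℝ) (C C' φ : ℝ → ℝ) (u θ r θ' r' : ℝ) : ℝ :=
  n - γ / 2 * tinv r * C (θ / n) * (u - φ (γ' * r' * C' (θ' / n)))

/-- radial part of the field -/
def vr (n : ℕ) (γ γ' : ℝ) (D C' φ : ℝ → ℝ) (u θ θ' r' : ℝ) : ℝ :=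
  γ / (2 * n) * D (θ / n) * (u - φ (γ' * r' * C' (θ' / n)))

lemma ll_div {f : X → ℝ} (hf : LocallyLipschitz f) (n : ℕ) :
    LocallyLipschitz fun x => f x / n := by
  simp only [div_eq_mul_inv]
  exact ll_mul hf (LocallyLipschitz.const _)

lemma ll_vθ (n : ℕ) (γ γ' : ℝ) {C C' φ : ℝ → ℝ} (hC : LocallyLipschitz C) (hC' : LocallyLipschitz C')
    (hφ : LocallyLipschitz φ) {u θ r θ' r' : X → ℝ} (hu : LocallyLipschitz u)
    (hθ : LocallyLipschitz θ) (hr : LocallyLipschitz r) (hθ' : LocallyLipschitz θ')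
    (hr' : LocallyLipschitz r') :
    LocallyLipschitz fun x => vθ n γ γ' C C' φ (u x) (θ x) (r x) (θ' x) (r' x) := by
  unfold vθ
  have c : ∀ c : ℝ, LocallyLipschitz fun _ : X => c := LocallyLipschitz.const
  exact ll_sub (c _) (ll_mul (ll_mul (ll_mul (c _) (tinv_ll.comp hr)) (hC.comp (ll_div hθ n)))
    (ll_sub hu (hφ.comp (ll_mul (ll_mul (c _) hr') (hC'.comp (ll_div hθ' n))))))

lemma ll_vr (n : ℕ) (γ γ' : ℝ) {C C' φ : ℝ → ℝ} (hC : LocallyLipschitz C) (hC' : LocallyLipschitz C')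
    (hφ : LocallyLipschitz φ) {u θ θ' r' : X → ℝ} (hu : LocallyLipschitz u)
    (hθ : LocallyLipschitz θ) (hθ' : LocallyLipschitz θ')
    (hr' : LocallyLipschitz r') :
    LocallyLipschitz fun x => vr n γ γ' C C' φ (u x) (θ x) (θ' x) (r' x) := by
  unfold vr
  have c : ∀ c : ℝ, LocallyLipschitz fun _ : X => c := LocallyLipschitz.const
  exact ll_mul (ll_mul (c _) (hC.comp (ll_div hθ n)))
    (ll_sub hu (hφ.comp (ll_mul (ll_mul (c _) hr') (hC'.comp (ll_div hθ' n)))))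

lemma bd_vθ {n : ℕ} {γ γ' M P : ℝ} {C C' φ : ℝ → ℝ} (hγ : 0 < γ) (hM : 0 < M) (_hP : 0 < P)
    (hC : ∀ t, |C t| ≤ M) (hφ : ∀ t, |φ t| ≤ P) {u : ℝ} (hu : |u| ≤ P) (θ r θ' r' : ℝ) :
    |vθ n γ γ' C C' φ u θ r θ' r'| ≤ n + γ * M * P := by
  unfold vθ
  refine (abs_sub _ _).trans ?_
  rw [abs_of_nonneg (Nat.cast_nonneg n)]
  gcongr
  have h1 : |u - φ (γ' * r' * C' (θ' / n))| ≤ 2 * P := by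
    refine (abs_sub _ _).trans ?_
    linarith [hφ (γ' * r' * C' (θ' / n))]
  rw [abs_mul, abs_mul, abs_mul, abs_of_pos (show 0 < γ / 2 by positivity)]
  calc γ / 2 * |tinv r| * |C (θ / n)| * |u - φ (γ' * r' * C' (θ' / n))| ≤ γ / 2 * 1 * M * (2 * P) := by
        gcongr
        · exact tinv_abs r
        · exact hC _
    _ = γ * M * P := by ring

lemma bd_vr {n : ℕ} (hn : 1 ≤ n) {γ γ' M P : ℝ} {C C' φ : ℝ → ℝ} (hγ : 0 < γ) (hM : 0 < M) (_hP : 0 < P)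
    (hC : ∀ t, |C t| ≤ M) (hφ : ∀ t, |φ t| ≤ P) {u : ℝ} (hu : |u| ≤ P) (θ θ' r' : ℝ) :
    |vr n γ γ' C C' φ u θ θ' r'| ≤ n + γ * M * P := by
  have hn1 : (1 : ℝ) ≤ n := by exact_mod_cast hn
  unfold vr
  have h1 : |u - φ (γ' * r' * C' (θ' / n))| ≤ 2 * P := by
    refine (abs_sub _ _).trans ?_
    linarith [hφ (γ' * r' * C' (θ' / n))]
  rw [abs_mul, abs_mul, abs_of_pos (show 0 < γ / (2 * n) by positivity)]
  calc γ / (2 * n) * |C (θ / n)| * |u - φ (γ' * r' * C' (θ' / n))| ≤ γ / (2 * 1) * M * (2 * P) := by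
        gcongr
        exact hC _
    _ = 0 + γ * M * P := by ring
    _ ≤ n + γ * M * P := by gcongr; linarith

end existence

lemma exists_sol {n : ℕ} (hn : 1 ≤ n) {C₁ C₂ : ℝ → ℝ}
    {M P γ₁ γ₂ : ℝ} (hM : 0 < M) (hP : 0 < P) (hγ₁ : 0 < γ₁) (hγ₂ : 0 < γ₂)
    (hreg₁ : ∀ t, AsymShape.Reg C₁ M t) (hreg₂ : ∀ t, AsymShape.Reg C₂ M t)
    {p₁ p₂ φ₁ φ₂ : ℝ → ℝ} (hp₁ : Continuous p₁) (hp₂ : Continuous p₂)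
    (hpb₁ : ∀ t ∈ Set.Icc (-1:ℝ) (2 * π + 1), |p₁ t| ≤ P)
    (hpb₂ : ∀ t ∈ Set.Icc (-1:ℝ) (2 * π + 1), |p₂ t| ≤ P)
    (hφ₁ : LocallyLipschitz φ₁) (hφ₂ : LocallyLipschitz φ₂)
    (hφb₁ : ∀ t, |φ₁ t| ≤ P) (hφb₂ : ∀ t, |φ₂ t| ≤ P) :
    ∃ R > 0, ∀ x y r s : ℝ, R ≤ r → R ≤ s → ∃ θ₁ θ₂ r₁ r₂ : ℝ → ℝ,
      θ₁ 0 = x ∧ θ₂ 0 = y ∧ r₁ 0 = r ∧ r₂ 0 = s ∧ Sol n γ₁ γ₂ C₁ C₂ p₁ p₂ φ₁ φ₂ θ₁ θ₂ r₁ r₂ := by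
  have hpi := pi_pos
  have hlip : ∀ f : ℝ → ℝ, (∀ x y, |f x - f y| ≤ M * |x - y|) → LocallyLipschitz f := by
    intro f hf
    have : LipschitzWith ⟨M, hM.le⟩ f := LipschitzWith.of_dist_le_mul fun x y => by
      rw [Real.dist_eq, Real.dist_eq]; exact hf x y
    exact this.locallyLipschitz
  have lC₁ := hlip _ (lip_of_deriv (fun t => (hreg₁ t).2.1) (fun t => (hreg₁ t).2.2.1))
  have lC₂ := hlip _ (lip_of_deriv (fun t => (hreg₂ t).2.1) (fun t => (hreg₂ t).2.2.1))
  have lD₁ := hlip _ (lip_of_deriv (fun t => (hreg₁ t).2.2.2.1) (fun t => (hreg₁ t).2.2.2.2))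
  have lD₂ := hlip _ (lip_of_deriv (fun t => (hreg₂ t).2.2.2.1) (fun t => (hreg₂ t).2.2.2.2))
  let F : (ℝ × ℝ) × (ℝ × ℝ × ℝ × ℝ) → ℝ × ℝ × ℝ × ℝ := fun q =>
    (vθ n γ₁ γ₂ C₁ C₂ φ₁ q.1.1 q.2.1 q.2.2.2.1 q.2.2.1 q.2.2.2.2,
     vθ n γ₂ γ₁ C₂ C₁ φ₂ q.1.2 q.2.2.1 q.2.2.2.2 q.2.1 q.2.2.2.1,
     vr n γ₁ γ₂ (deriv C₁) C₂ φ₁ q.1.1 q.2.1 q.2.2.1 q.2.2.2.2,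
     vr n γ₂ γ₁ (deriv C₂) C₁ φ₂ q.1.2 q.2.2.1 q.2.1 q.2.2.2.1)
  have hF : LocallyLipschitz F := by
    have u1 : LocallyLipschitz fun q : (ℝ × ℝ) × (ℝ × ℝ × ℝ × ℝ) => q.1.1 :=
      ContDiff.locallyLipschitz (𝕂 := ℝ) (by fun_prop)
    have u2 : LocallyLipschitz fun q : (ℝ × ℝ) × (ℝ × ℝ × ℝ × ℝ) => q.1.2 :=
      ContDiff.locallyLipschitz (𝕂 := ℝ) (by fun_prop)
    have x1 : LocallyLipschitz fun q : (ℝ × ℝ) × (ℝ × ℝ × ℝ × ℝ) => q.2.1 :=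
      ContDiff.locallyLipschitz (𝕂 := ℝ) (by fun_prop)
    have x2 : LocallyLipschitz fun q : (ℝ × ℝ) × (ℝ × ℝ × ℝ × ℝ) => q.2.2.1 :=
      ContDiff.locallyLipschitz (𝕂 := ℝ) (by fun_prop)
    have x3 : LocallyLipschitz fun q : (ℝ × ℝ) × (ℝ × ℝ × ℝ × ℝ) => q.2.2.2.1 :=
      ContDiff.locallyLipschitz (𝕂 := ℝ) (by fun_prop)
    have x4 : LocallyLipschitz fun q : (ℝ × ℝ) × (ℝ × ℝ × ℝ × ℝ) => q.2.2.2.2 :=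
      ContDiff.locallyLipschitz (𝕂 := ℝ) (by fun_prop)
    exact (ll_vθ n γ₁ γ₂ lC₁ lC₂ hφ₁ u1 x1 x3 x2 x4).prodMk
      ((ll_vθ n γ₂ γ₁ lC₂ lC₁ hφ₂ u2 x2 x4 x1 x3).prodMk
      ((ll_vr n γ₁ γ₂ lD₁ lC₂ hφ₁ u1 x1 x2 x4).prodMk (ll_vr n γ₂ γ₁ lD₂ lC₁ hφ₂ u2 x2 x1 x3)))
  set N : ℝ := n + (γ₁ + γ₂) * M * P with hN
  have hN0 : 0 < N := by positivity
  have hN₁ : n + γ₁ * M * P ≤ N := by rw [hN]; gcongr; linarith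
  have hN₂ : n + γ₂ * M * P ≤ N := by rw [hN]; gcongr; linarith
  refine ⟨1 + 2 * π * N, by positivity, ?_⟩
  intro x y r s hr hs
  let x₀ : ℝ × ℝ × ℝ × ℝ := (x, y, r, s)
  let a : NNReal := ⟨N * (2 * π + 1), by positivity⟩
  obtain ⟨K, hK⟩ := LocallyLipschitzOn.exists_lipschitzOnWith_of_compact
    ((isCompact_closedBall (0 : ℝ × ℝ) P).prod (isCompact_closedBall x₀ a)) hF.locallyLipschitzOn
  let f : ℝ → ℝ × ℝ × ℝ × ℝ → ℝ × ℝ × ℝ × ℝ := fun t z => F ((p₁ t, p₂ t), z)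
  have hmem : ∀ t ∈ Set.Icc (-1:ℝ) (2 * π + 1), (p₁ t, p₂ t) ∈ Metric.closedBall (0 : ℝ × ℝ) P := by
    intro t ht
    rw [mem_closedBall_zero_iff, Prod.norm_def]
    exact max_le (hpb₁ t ht) (hpb₂ t ht)
  let t₀ : Set.Icc (-1:ℝ) (2 * π + 1) := ⟨0, by norm_num, by positivity⟩
  have hPL : IsPicardLindelof f t₀ x₀ a 0 ⟨N, hN0.le⟩ K := by
    refine ⟨?_, ?_, ?_, ?_⟩
    · intro t ht z hz z' hz'
      have : edist (F ((p₁ t, p₂ t), z)) (F ((p₁ t, p₂ t), z')) ≤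
          K * edist (((p₁ t, p₂ t), z) : (ℝ × ℝ) × (ℝ × ℝ × ℝ × ℝ)) ((p₁ t, p₂ t), z') :=
        hK (Set.mk_mem_prod (hmem t ht) hz) (Set.mk_mem_prod (hmem t ht) hz')
      refine this.trans ?_
      simp [Prod.edist_eq]
    · intro z _
      exact (hF.continuous.comp ((hp₁.prodMk hp₂).prodMk continuous_const)).continuousOn
    · intro t ht z _
      have c1 := hpb₁ t ht
      have c2 := hpb₂ t ht
      simp only [Prod.norm_def, f, F]
      refine max_le ?_ (max_le ?_ (max_le ?_ ?_))
      · exact (bd_vθ hγ₁ hM hP (fun t => (hreg₁ t).1) hφb₁ c1 _ _ _ _).trans hN₁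
      · exact (bd_vθ hγ₂ hM hP (fun t => (hreg₂ t).1) hφb₂ c2 _ _ _ _).trans hN₂
      · exact (bd_vr hn hγ₁ hM hP (fun t => (hreg₁ t).2.2.1) hφb₁ c1 _ _ _).trans hN₁
      · exact (bd_vr hn hγ₂ hM hP (fun t => (hreg₂ t).2.2.1) hφb₂ c2 _ _ _).trans hN₂
    · have : max (2 * π + 1 - (t₀ : ℝ)) ((t₀ : ℝ) - (-1)) = 2 * π + 1 := by
        simp only [t₀]
        rw [max_eq_left] <;> linarith
      rw [this, NNReal.coe_zero, sub_zero]
      exact le_of_eq rfl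
  obtain ⟨α, hα0, hα⟩ := hPL.exists_eq_forall_mem_Icc_hasDerivWithinAt₀
  have hα0' : α 0 = (x, y, r, s) := hα0
  have hd : ∀ t ∈ Set.Icc (0:ℝ) (2 * π), HasDerivAt α (f t (α t)) t := by
    intro t ht
    exact (hα t ⟨by linarith [ht.1], by linarith [ht.2]⟩).hasDerivAt
      (Icc_mem_nhds (by linarith [ht.1]) (by linarith [ht.2]))
  have d1 : ∀ t ∈ Set.Icc (0:ℝ) (2 * π), HasDerivAt (fun t => (α t).1) (f t (α t)).1 t :=
    fun t ht => (hd t ht).fst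
  have d2 : ∀ t ∈ Set.Icc (0:ℝ) (2 * π), HasDerivAt (fun t => (α t).2.1) (f t (α t)).2.1 t :=
    fun t ht => (hd t ht).snd.fst
  have d3 : ∀ t ∈ Set.Icc (0:ℝ) (2 * π), HasDerivAt (fun t => (α t).2.2.1) (f t (α t)).2.2.1 t :=
    fun t ht => (hd t ht).snd.snd.fst
  have d4 : ∀ t ∈ Set.Icc (0:ℝ) (2 * π), HasDerivAt (fun t => (α t).2.2.2) (f t (α t)).2.2.2 t :=
    fun t ht => (hd t ht).snd.snd.snd
  have hsub : ∀ t ∈ Set.Icc (0:ℝ) (2 * π), t ∈ Set.Icc (-1:ℝ) (2 * π + 1) :=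
    fun t ht => ⟨by linarith [ht.1], by linarith [ht.2]⟩
  have b3 := mvt_bd hN0.le d3 (fun t ht =>
    (bd_vr hn hγ₁ hM hP (fun t => (hreg₁ t).2.2.1) hφb₁ (hpb₁ t (hsub t ht)) _ _ _).trans hN₁)
  have b4 := mvt_bd hN0.le d4 (fun t ht =>
    (bd_vr hn hγ₂ hM hP (fun t => (hreg₂ t).2.2.1) hφb₂ (hpb₂ t (hsub t ht)) _ _ _).trans hN₂)
  simp only [hα0'] at b3 b4
  refine ⟨fun t => (α t).1, fun t => (α t).2.1, fun t => (α t).2.2.1, fun t => (α t).2.2.2,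
    by simp [hα0'], by simp [hα0'], by simp [hα0'], by simp [hα0'], ?_⟩
  intro t ht
  have e3 : 1 ≤ (α t).2.2.1 := by linarith [(abs_le.1 (b3 t ht)).1]
  have e4 : 1 ≤ (α t).2.2.2 := by linarith [(abs_le.1 (b4 t ht)).1]
  refine ⟨by linarith, by linarith, ?_, ?_, d3 t ht, d4 t ht⟩
  · refine (d1 t ht).congr_deriv ?_
    simp only [f, F, vθ, tinv_eq e3]
    field_simp
  · refine (d2 t ht).congr_deriv ?_
    simp only [f, F, vθ, tinv_eq e4]
    field_simp

lemma phi_deriv {n : ℕ} {C p Φ : ℝ → ℝ} {M c : ℝ} (hM : 0 < M) (hreg : ∀ t, AsymShape.Reg C M t)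
    (hp : Continuous p) (hΦ : ∀ θ, Φ θ = c * ∫ t in (0 : ℝ)..(2 * π), C (θ / n + t) * p t) (x : ℝ) :
    HasDerivAt Φ (c * (1 / n * ∫ t in (0 : ℝ)..(2 * π), deriv C (x / n + t) * p t)) x := by
  have dC : Differentiable ℝ C := fun t => (hreg t).2.1
  have dD : Differentiable ℝ (deriv C) := fun t => (hreg t).2.2.2.1
  have cC := dC.continuous
  have cD := dD.continuous
  have e : Φ = fun θ => c * ∫ t in (0 : ℝ)..(2 * π), C (θ / n + t) * p t := funext hΦ
  rw [e, ← intervalIntegral.integral_const_mul]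
  refine HasDerivAt.const_mul c ?_
  refine (intervalIntegral.hasDerivAt_integral_of_dominated_loc_of_deriv_le (𝕜 := ℝ)
    (F := fun θ t => C (θ / n + t) * p t) (F' := fun θ t => 1 / (n : ℝ) * (deriv C (θ / n + t) * p t))
    (bound := fun t => |1 / (n : ℝ)| * (M * |p t|)) (s := Set.univ) Filter.univ_mem ?_ ?_ ?_ ?_ ?_ ?_).2
  · refine Filter.Eventually.of_forall fun θ => ?_
    exact Continuous.aestronglyMeasurable (by fun_prop)
  · exact Continuous.intervalIntegrable (by fun_prop) _ _
  · exact Continuous.aestronglyMeasurable (by fun_prop)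
  · refine Filter.Eventually.of_forall fun t _ θ _ => ?_
    rw [Real.norm_eq_abs, abs_mul, abs_mul]
    gcongr
    exact (hreg _).2.2.1
  · exact Continuous.intervalIntegrable (by fun_prop) _ _
  · refine Filter.Eventually.of_forall fun t _ θ _ => ?_
    have h1 : HasDerivAt (fun θ : ℝ => θ / n + t) (1 / n) θ :=
      ((hasDerivAt_id' θ).div_const (n:ℝ)).add_const t
    have h2 := ((dC (θ / n + t)).hasDerivAt.comp θ h1).mul_const (p t)
    exact h2.congr_deriv (by ring)

lemma lam_deriv {n : ℕ} {C K Λ : ℝ → ℝ} {h : ℝ} (hC : Continuous C)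
    (hK : ∀ t, K t = ∫ s in (0 : ℝ)..t, C s) (hΛ : ∀ t, Λ t = K (t / n + h) - K (t / n - h)) (x : ℝ) :
    HasDerivAt Λ (1 / n * (C (x / n + h) - C (x / n - h))) x := by
  have dK : ∀ t, HasDerivAt K (C t) t := by
    intro t
    rw [show K = fun t => ∫ s in (0 : ℝ)..t, C s from funext hK]
    exact intervalIntegral.integral_hasDerivAt_right (hC.intervalIntegrable _ _)
      hC.stronglyMeasurable.stronglyMeasurableAtFilter hC.continuousAt
  rw [show Λ = fun t => K (t / n + h) - K (t / n - h) from funext hΛ]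
  have h1 : HasDerivAt (fun θ : ℝ => θ / n + h) (1 / n) x :=
      ((hasDerivAt_id' x).div_const (n:ℝ)).add_const h
  have h2 : HasDerivAt (fun θ : ℝ => θ / n - h) (1 / n) x :=
      ((hasDerivAt_id' x).div_const (n:ℝ)).sub_const h
  exact (((dK _).comp x h1).sub ((dK _).comp x h2)).congr_deriv (by ring)

lemma lam_eq {n : ℕ} {C K Λ : ℝ → ℝ} {h : ℝ} (hC : Continuous C)
    (hK : ∀ t, K t = ∫ s in (0 : ℝ)..t, C s) (hΛ : ∀ t, Λ t = K (t / n + h) - K (t / n - h)) (x : ℝ) :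
    Λ x = ∫ s in (x / n - h)..(x / n + h), C s := by
  rw [hΛ, hK, hK, intervalIntegral.integral_interval_sub_left] <;> exact hC.intervalIntegrable _ _

lemma aux_fderiv_fst {Φ Λ : ℝ → ℝ} {L : ℝ × ℝ → ℝ} {c α Φ' Λ' : ℝ} {θ : ℝ × ℝ}
    (hL : ∀ θ : ℝ × ℝ, L θ = Φ θ.1 + c * (Λ (θ.1 - θ.2) - α))
    (h1 : HasDerivAt Φ Φ' θ.1) (h2 : HasDerivAt Λ Λ' (θ.1 - θ.2)) :
    fderiv ℝ L θ (1, 0) = Φ' + c * Λ' := by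
  rw [show L = fun θ : ℝ × ℝ => Φ θ.1 + c * (Λ (θ.1 - θ.2) - α) from funext hL]
  have e1 : HasFDerivAt (fun θ : ℝ × ℝ => θ.1) (ContinuousLinearMap.fst ℝ ℝ ℝ) θ := hasFDerivAt_fst
  have e2 : HasFDerivAt (fun θ : ℝ × ℝ => θ.2) (ContinuousLinearMap.snd ℝ ℝ ℝ) θ := hasFDerivAt_snd
  have f1 := h1.comp_hasFDerivAt θ e1
  have f2 := h2.comp_hasFDerivAt θ (e1.sub e2)
  have f3 := f1.add ((f2.sub_const α).const_mul c)
  have := f3.fderiv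
  simp only [Function.comp_def] at this
  erw [this]
  simp

lemma aux_fderiv_snd {Φ Λ : ℝ → ℝ} {L : ℝ × ℝ → ℝ} {c α Φ' Λ' : ℝ} {θ : ℝ × ℝ}
    (hL : ∀ θ : ℝ × ℝ, L θ = Φ θ.2 + c * (Λ (θ.2 - θ.1) - α))
    (h1 : HasDerivAt Φ Φ' θ.2) (h2 : HasDerivAt Λ Λ' (θ.2 - θ.1)) :
    fderiv ℝ L θ (0, 1) = Φ' + c * Λ' := by
  rw [show L = fun θ : ℝ × ℝ => Φ θ.2 + c * (Λ (θ.2 - θ.1) - α) from funext hL]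
  have e1 : HasFDerivAt (fun θ : ℝ × ℝ => θ.1) (ContinuousLinearMap.fst ℝ ℝ ℝ) θ := hasFDerivAt_fst
  have e2 : HasFDerivAt (fun θ : ℝ × ℝ => θ.2) (ContinuousLinearMap.snd ℝ ℝ ℝ) θ := hasFDerivAt_snd
  have f1 := h1.comp_hasFDerivAt θ e2
  have f2 := h2.comp_hasFDerivAt θ (e2.sub e1)
  have f3 := f1.add ((f2.sub_const α).const_mul c)
  have := f3.fderiv
  simp only [Function.comp_def] at this
  erw [this]
  simp

lemma cont_bd {p : ℝ → ℝ} (hp : Continuous p) :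
    ∃ P, ∀ t ∈ Set.Icc (-1:ℝ) (2 * π + 1), |p t| ≤ P :=
  isCompact_Icc.exists_bound_of_continuousOn hp.continuousOn

lemma AsymShape.Reg.mono {C : ℝ → ℝ} {M M' t : ℝ} (h : AsymShape.Reg C M t) (hM : M ≤ M') :
    AsymShape.Reg C M' t :=
  ⟨h.1.trans hM, h.2.1, h.2.2.1.trans hM, h.2.2.2.1, h.2.2.2.2.trans hM⟩


theorem stmt16 (n : ℕ) (hn : 1 ≤ n)
    (a₁ b₁ a₂ b₂ : ℝ)
    (ha₁ : (n : ℝ) ^ 2 / 4 < a₁) (hb₁ : 0 < b₁)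
    (ha₂ : (n : ℝ) ^ 2 / 4 < a₂) (hb₂ : 0 < b₂)
    (hres₁ : 1 / Real.sqrt a₁ + 1 / Real.sqrt b₁ = 2 / (n : ℝ))
    (hres₂ : 1 / Real.sqrt a₂ + 1 / Real.sqrt b₂ = 2 / (n : ℝ))
    (C₁ C₂ : ℝ → ℝ) (hC₁ : IsAsymCos n a₁ b₁ C₁) (hC₂ : IsAsymCos n a₂ b₂ C₂)
    (γ₁ γ₂ α₁ α₂ : ℝ)
    (hγ₁ : γ₁ = Real.sqrt (2 * n / a₁)) (hγ₂ : γ₂ = Real.sqrt (2 * n / a₂))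
    (hα₁ : α₁ = 1 / Real.sqrt a₁ - Real.sqrt a₁ / b₁)
    (hα₂ : α₂ = 1 / Real.sqrt a₂ - Real.sqrt a₂ / b₂)
    (K₁ K₂ : ℝ → ℝ)
    (hK₁ : ∀ t, K₁ t = ∫ s in (0 : ℝ)..t, C₁ s)
    (hK₂ : ∀ t, K₂ t = ∫ s in (0 : ℝ)..t, C₂ s)
    (Λ₁ Λ₂ : ℝ → ℝ)
    (hΛ₁ : ∀ t, Λ₁ t = K₁ (t / n + π / (2 * Real.sqrt a₂)) - K₁ (t / n - π / (2 * Real.sqrt a₂)))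
    (hΛ₂ : ∀ t, Λ₂ t = K₂ (t / n + π / (2 * Real.sqrt a₁)) - K₂ (t / n - π / (2 * Real.sqrt a₁)))
    (p₁ p₂ : ℝ → ℝ) (hp₁ : Continuous p₁) (hp₂ : Continuous p₂)
    (hp₁per : ∀ t, p₁ (t + 2 * π) = p₁ t) (hp₂per : ∀ t, p₂ (t + 2 * π) = p₂ t)
    (φ₁ φ₂ : ℝ → ℝ) (hφ₁lip : LocallyLipschitz φ₁) (hφ₂lip : LocallyLipschitz φ₂)
    (hφ₁bdd : ∃ M, ∀ x, |φ₁ x| ≤ M) (hφ₂bdd : ∃ M, ∀ x, |φ₂ x| ≤ M)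
    (φ₁inf φ₂inf : ℝ)
    (hφ₁top : Tendsto φ₁ atTop (nhds φ₁inf)) (hφ₁bot : Tendsto φ₁ atBot (nhds (-φ₁inf)))
    (hφ₂top : Tendsto φ₂ atTop (nhds φ₂inf)) (hφ₂bot : Tendsto φ₂ atBot (nhds (-φ₂inf)))
    (Φ₁ Φ₂ : ℝ → ℝ)
    (hΦ₁ : ∀ θ, Φ₁ θ = -(γ₁ / 2) * ∫ t in (0 : ℝ)..(2 * π), C₁ (θ / n + t) * p₁ t)
    (hΦ₂ : ∀ θ, Φ₂ θ = -(γ₂ / 2) * ∫ t in (0 : ℝ)..(2 * π), C₂ (θ / n + t) * p₂ t)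
    (L₁ L₂ : ℝ × ℝ → ℝ)
    (hL₁ : ∀ θ : ℝ × ℝ, L₁ θ = Φ₁ θ.1 + γ₁ * n * φ₁inf * (Λ₁ (θ.1 - θ.2) - α₁))
    (hL₂ : ∀ θ : ℝ × ℝ, L₂ θ = Φ₂ θ.2 + γ₂ * n * φ₂inf * (Λ₂ (θ.2 - θ.1) - α₂)) :
    ∀ δ > (0 : ℝ), ∃ R > (0 : ℝ), ∀ θ₀ r₀ : ℝ × ℝ, R ≤ r₀.1 → R ≤ r₀.2 →
      (∃ θ₁ θ₂ r₁ r₂ : ℝ → ℝ,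
        (θ₁ 0 = θ₀.1 ∧ θ₂ 0 = θ₀.2 ∧ r₁ 0 = r₀.1 ∧ r₂ 0 = r₀.2 ∧
          ∀ t ∈ Set.Icc (0 : ℝ) (2 * π),
            0 < r₁ t ∧ 0 < r₂ t ∧
            HasDerivAt θ₁ ((n : ℝ) - γ₁ / (2 * r₁ t) * C₁ (θ₁ t / n) *
              (p₁ t - φ₁ (γ₂ * r₂ t * C₂ (θ₂ t / n)))) t ∧
            HasDerivAt θ₂ ((n : ℝ) - γ₂ / (2 * r₂ t) * C₂ (θ₂ t / n) *
              (p₂ t - φ₂ (γ₁ * r₁ t * C₁ (θ₁ t / n)))) t ∧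
            HasDerivAt r₁ (γ₁ / (2 * n) * deriv C₁ (θ₁ t / n) *
              (p₁ t - φ₁ (γ₂ * r₂ t * C₂ (θ₂ t / n)))) t ∧
            HasDerivAt r₂ (γ₂ / (2 * n) * deriv C₂ (θ₂ t / n) *
              (p₂ t - φ₂ (γ₁ * r₁ t * C₁ (θ₁ t / n)))) t) ∧
        (|r₁ (2 * π) - r₀.1 + fderiv ℝ L₁ θ₀ (1, 0)| ≤ δ ∧
          |r₂ (2 * π) - r₀.2 + fderiv ℝ L₂ θ₀ (0, 1)| ≤ δ ∧
          |r₀.1 * (θ₁ (2 * π) - θ₀.1 - 2 * π * n) - L₁ θ₀| ≤ δ ∧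
          |r₀.2 * (θ₂ (2 * π) - θ₀.2 - 2 * π * n) - L₂ θ₀| ≤ δ)) ∧
      (∀ θ₁ θ₂ r₁ r₂ : ℝ → ℝ,
        (θ₁ 0 = θ₀.1 ∧ θ₂ 0 = θ₀.2 ∧ r₁ 0 = r₀.1 ∧ r₂ 0 = r₀.2 ∧
          ∀ t ∈ Set.Icc (0 : ℝ) (2 * π),
            0 < r₁ t ∧ 0 < r₂ t ∧
            HasDerivAt θ₁ ((n : ℝ) - γ₁ / (2 * r₁ t) * C₁ (θ₁ t / n) *
              (p₁ t - φ₁ (γ₂ * r₂ t * C₂ (θ₂ t / n)))) t ∧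
            HasDerivAt θ₂ ((n : ℝ) - γ₂ / (2 * r₂ t) * C₂ (θ₂ t / n) *
              (p₂ t - φ₂ (γ₁ * r₁ t * C₁ (θ₁ t / n)))) t ∧
            HasDerivAt r₁ (γ₁ / (2 * n) * deriv C₁ (θ₁ t / n) *
              (p₁ t - φ₁ (γ₂ * r₂ t * C₂ (θ₂ t / n)))) t ∧
            HasDerivAt r₂ (γ₂ / (2 * n) * deriv C₂ (θ₂ t / n) *
              (p₂ t - φ₂ (γ₁ * r₁ t * C₁ (θ₁ t / n)))) t) →
        (|r₁ (2 * π) - r₀.1 + fderiv ℝ L₁ θ₀ (1, 0)| ≤ δ ∧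
          |r₂ (2 * π) - r₀.2 + fderiv ℝ L₂ θ₀ (0, 1)| ≤ δ ∧
          |r₀.1 * (θ₁ (2 * π) - θ₀.1 - 2 * π * n) - L₁ θ₀| ≤ δ ∧
          |r₀.2 * (θ₂ (2 * π) - θ₀.2 - 2 * π * n) - L₂ θ₀| ≤ δ)) := by
  intro δ hδ
  have hn0 : (0 : ℝ) < n := by exact_mod_cast hn
  have ha₁0 : 0 < a₁ := lt_of_le_of_lt (by positivity) ha₁
  have ha₂0 : 0 < a₂ := lt_of_le_of_lt (by positivity) ha₂
  have gp₁ : 0 < γ₁ := by rw [hγ₁]; exact Real.sqrt_pos.2 (by positivity)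
  have gp₂ : 0 < γ₂ := by rw [hγ₂]; exact Real.sqrt_pos.2 (by positivity)
  have S₁ := asymShape_of n hn a₁ b₁ ha₁ hb₁ hres₁ C₁ hC₁
  have S₂ := asymShape_of n hn a₂ b₂ ha₂ hb₂ hres₂ C₂ hC₂
  have hT : (n : ℝ) * (2 * π / n) = 2 * π := by field_simp
  obtain ⟨M₁, hM₁, reg₁'⟩ := S₁.reg
  obtain ⟨M₂, hM₂, reg₂'⟩ := S₂.reg
  set M := max M₁ M₂ with hMdef
  have hM : 0 < M := lt_of_lt_of_le hM₁ (le_max_left _ _)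
  have reg₁ : ∀ t, AsymShape.Reg C₁ M t := fun t => (reg₁' t).mono (le_max_left _ _)
  have reg₂ : ∀ t, AsymShape.Reg C₂ M t := fun t => (reg₂' t).mono (le_max_right _ _)
  have cC₁ : Continuous C₁ := Differentiable.continuous (𝕜 := ℝ) fun t => (reg₁ t).2.1
  have cC₂ : Continuous C₂ := Differentiable.continuous (𝕜 := ℝ) fun t => (reg₂ t).2.1
  obtain ⟨P₁, hP₁⟩ := cont_bd hp₁
  obtain ⟨P₂, hP₂⟩ := cont_bd hp₂
  obtain ⟨Q₁, hQ₁⟩ := hφ₁bdd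
  obtain ⟨Q₂, hQ₂⟩ := hφ₂bdd
  obtain ⟨P, hP, hP₁P, hP₂P, hQ₁P, hQ₂P⟩ : ∃ P : ℝ, 0 < P ∧ P₁ ≤ P ∧ P₂ ≤ P ∧ Q₁ ≤ P ∧ Q₂ ≤ P := by
    refine ⟨1 + |P₁| + |P₂| + |Q₁| + |Q₂|, by positivity, ?_, ?_, ?_, ?_⟩ <;>
    linarith [le_abs_self P₁, le_abs_self P₂, le_abs_self Q₁, le_abs_self Q₂, abs_nonneg P₁,
      abs_nonneg P₂, abs_nonneg Q₁, abs_nonneg Q₂]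
  have pb₁ : ∀ t ∈ Set.Icc (-1:ℝ) (2 * π + 1), |p₁ t| ≤ P := fun t ht => (hP₁ t ht).trans hP₁P
  have pb₂ : ∀ t ∈ Set.Icc (-1:ℝ) (2 * π + 1), |p₂ t| ≤ P := fun t ht => (hP₂ t ht).trans hP₂P
  have fb₁ : ∀ t, |φ₁ t| ≤ P := fun t => (hQ₁ t).trans hQ₁P
  have fb₂ : ∀ t, |φ₂ t| ≤ P := fun t => (hQ₂ t).trans hQ₂P
  have hsub : ∀ t ∈ Set.Icc (0:ℝ) (2 * π), t ∈ Set.Icc (-1:ℝ) (2 * π + 1) :=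
    fun t ht => ⟨by linarith [ht.1], by linarith [ht.2]⟩
  obtain ⟨R₁, hR₁, H₁⟩ := half hn S₁ S₂ hT hM hP gp₁ gp₂ reg₁ reg₂ hp₁
    (fun t ht => pb₁ t (hsub t ht)) (fun t ht => pb₂ t (hsub t ht)) hφ₁lip.continuous fb₁ fb₂
    hφ₁top hφ₁bot hδ
  obtain ⟨R₂, hR₂, H₂⟩ := half hn S₂ S₁ hT hM hP gp₂ gp₁ reg₂ reg₁ hp₂
    (fun t ht => pb₂ t (hsub t ht)) (fun t ht => pb₁ t (hsub t ht)) hφ₂lip.continuous fb₂ fb₁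
    hφ₂top hφ₂bot hδ
  obtain ⟨R₃, hR₃, H₃⟩ := exists_sol hn hM hP gp₁ gp₂ reg₁ reg₂ hp₁ hp₂ pb₁ pb₂ hφ₁lip hφ₂lip fb₁ fb₂
  refine ⟨R₁ + R₂ + R₃, by positivity, ?_⟩
  intro θ₀ r₀ hr1 hr2
  have main : ∀ θ₁ θ₂ r₁ r₂ : ℝ → ℝ, θ₁ 0 = θ₀.1 → θ₂ 0 = θ₀.2 → r₁ 0 = r₀.1 → r₂ 0 = r₀.2 →
      Sol n γ₁ γ₂ C₁ C₂ p₁ p₂ φ₁ φ₂ θ₁ θ₂ r₁ r₂ →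
        (|r₁ (2 * π) - r₀.1 + fderiv ℝ L₁ θ₀ (1, 0)| ≤ δ ∧
          |r₂ (2 * π) - r₀.2 + fderiv ℝ L₂ θ₀ (0, 1)| ≤ δ ∧
          |r₀.1 * (θ₁ (2 * π) - θ₀.1 - 2 * π * n) - L₁ θ₀| ≤ δ ∧
          |r₀.2 * (θ₂ (2 * π) - θ₀.2 - 2 * π * n) - L₂ θ₀| ≤ δ) := by
    intro θ₁ θ₂ r₁ r₂ i1 i2 i3 i4 hs
    have E₁ := H₁ (R₁ + R₂ + R₃) (by linarith) θ₁ θ₂ r₁ r₂ (by rw [i3]; exact hr1)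
      (by rw [i4]; exact hr2) hs
    have E₂ := H₂ (R₁ + R₂ + R₃) (by linarith) θ₂ θ₁ r₂ r₁ (by rw [i4]; exact hr2)
      (by rw [i3]; exact hr1) hs.swap
    rw [i1, i2, i3] at E₁
    rw [i1, i2, i4] at E₂
    rw [aux_fderiv_fst hL₁ (phi_deriv hM reg₁ hp₁ hΦ₁ _) (lam_deriv cC₁ hK₁ hΛ₁ _),
      aux_fderiv_snd hL₂ (phi_deriv hM reg₂ hp₂ hΦ₂ _) (lam_deriv cC₂ hK₂ hΛ₂ _), hL₁, hL₂, hΦ₁, hΦ₂,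
      lam_eq cC₁ hK₁ hΛ₁, lam_eq cC₂ hK₂ hΛ₂, hα₁, hα₂]
    rw [Real.sq_sqrt hb₁.le] at E₁
    rw [Real.sq_sqrt hb₂.le] at E₂
    exact ⟨E₁.1, E₂.1, E₁.2, E₂.2⟩
  refine ⟨?_, ?_⟩
  · obtain ⟨θ₁, θ₂, r₁, r₂, i1, i2, i3, i4, hs⟩ := H₃ θ₀.1 θ₀.2 r₀.1 r₀.2 (by linarith) (by linarith)
    exact ⟨θ₁, θ₂, r₁, r₂, ⟨i1, i2, i3, i4, hs⟩, main θ₁ θ₂ r₁ r₂ i1 i2 i3 i4 hs⟩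
  · rintro θ₁ θ₂ r₁ r₂ ⟨i1, i2, i3, i4, hs⟩
    exact main θ₁ θ₂ r₁ r₂ i1 i2 i3 i4 hs
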